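/- Let d ≥ 1 and let ℓ : [0,∞) → [0,∞) satisfy (A1,i): ℓ(0) = 0 and ℓ(ru) ≥ rℓ(u) for all r ∈ (0,1), u > 0. Let P₀, P₁ be Borel probability measures on ℝ^d. If X(·) is a minimizer of Ṽ₁(P₀,P₁), then the pair (X(0), X(1)) is a minimizer of T(P₀,P₁) with cost L(u) = ℓ(|u|). -/

import Mathlib

open MeasureTheory Set Filter
open scoped ENNReal NNReal Classical

noncomputable section

/-- `ℝ^d` with the Euclidean norm. -/
abbrev Vec (d : ℕ) := EuclideanSpace ℝ (Fin d)

/-- essential supremum of `|φ|` on `[0,t]` (`‖φ‖_{∞,t}`), as an extended nonnegative real. -/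
def eSupT {d : ℕ} (φ : ℝ → Vec d) (t : ℝ) : ℝ≥0∞ :=
  essSup (fun s => (‖φ s‖₊ : ℝ≥0∞)) (volume.restrict (Icc (0:ℝ) t))

/-- `‖φ‖_∞` on `[0,1]`. -/
def eSup01 {d : ℕ} (φ : ℝ → Vec d) : ℝ≥0∞ := eSupT φ 1

/-- `N₁(φ)_t`. -/
def N1T {d : ℕ} (φ : ℝ → Vec d) (t : ℝ) : ℝ :=
  if (∫ s in (0:ℝ)..t, φ s) ≠ 0 then t * (eSupT φ t).toReal / ‖∫ s in (0:ℝ)..t, φ s‖ else 1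

/-- `N₂(φ)_t`. -/
def N2T {d : ℕ} (φ : ℝ → Vec d) (t : ℝ) : ℝ :=
  if 0 < (∫ s in (0:ℝ)..t, ‖φ s‖) then t * (eSupT φ t).toReal / (∫ s in (0:ℝ)..t, ‖φ s‖) else 1

/-- `N₁(φ) = N₁(φ)₁`. -/
def N1 {d : ℕ} (φ : ℝ → Vec d) : ℝ := N1T φ 1

/-- `N₂(φ) = N₂(φ)₁`. -/
def N2 {d : ℕ} (φ : ℝ → Vec d) : ℝ := N2T φ 1

/-- the position at time `t` of the absolutely continuous path starting at `ξ`
with velocity `φ`. -/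
def pathAt {d : ℕ} (ξ : Vec d) (φ : ℝ → Vec d) (t : ℝ) : Vec d := ξ + ∫ s in (0:ℝ)..t, φ s

/-- the endpoint `X(1)` of the path starting at `ξ` with velocity `φ`. -/
def endPt {d : ℕ} (ξ : Vec d) (φ : ℝ → Vec d) : Vec d := ξ + ∫ s in (0:ℝ)..1, φ s

/-- The Monge–Kantorovich cost `T(P₀,P₁) = inf E[L(X₁ - X₀)]`, the infimum being over
pairs of random variables, on some probability space, with laws `P₀` and `P₁`. -/
def MKcost {d : ℕ} (L : Vec d → ℝ) (P₀ P₁ : Measure (Vec d)) : ℝ≥0∞ :=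
  sInf { c | ∃ (Ω : Type) (_ : MeasureSpace Ω), IsProbabilityMeasure (volume : Measure Ω) ∧
    ∃ (X₀ X₁ : Ω → Vec d), Measurable X₀ ∧ Measurable X₁ ∧
      Measure.map X₀ volume = P₀ ∧ Measure.map X₁ volume = P₁ ∧
      c = ∫⁻ ω, ENNReal.ofReal (L (X₁ ω - X₀ ω)) }

/-- `(X₀, X₁)` is a minimizer of `T(P₀,P₁)`. -/
def IsTMin {d : ℕ} (L : Vec d → ℝ) (P₀ P₁ : Measure (Vec d)) (Ω : Type) [MeasureSpace Ω]
    (X₀ X₁ : Ω → Vec d) : Prop :=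
  IsProbabilityMeasure (volume : Measure Ω) ∧ Measurable X₀ ∧ Measurable X₁ ∧
  Measure.map X₀ volume = P₀ ∧ Measure.map X₁ volume = P₁ ∧
  (∫⁻ ω, ENNReal.ofReal (L (X₁ ω - X₀ ω))) = MKcost L P₀ P₁

/-- The stochastic process determined by the (measurable) initial point `ξ` and velocity
process `φ`, namely `X(ω,t) = ξ ω + ∫₀ᵗ φ(ω,s) ds`, is a member of `𝒜_∞(P₀,P₁)`:
its paths are a.s. absolutely continuous with essentially bounded derivative and
`X(0), X(1)` have laws `P₀, P₁`. -/
def IsAdmissible {d : ℕ} (P₀ P₁ : Measure (Vec d)) (Ω : Type) [MeasureSpace Ω]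
    (ξ : Ω → Vec d) (φ : Ω → ℝ → Vec d) : Prop :=
  IsProbabilityMeasure (volume : Measure Ω) ∧ Measurable ξ ∧ Measurable (Function.uncurry φ) ∧
  (∀ᵐ ω ∂(volume : Measure Ω), eSup01 (φ ω) < ⊤) ∧
  Measure.map ξ volume = P₀ ∧ Measure.map (fun ω => endPt (ξ ω) (φ ω)) volume = P₁

/-- `∫₀¹ Lᵢ(t, φ) dt` where `Lᵢ(t,φ) = Nᵢ(φ) ℓ(|φ(t)|/Nᵢ(φ))`; `N` is `N₁` or `N₂`. -/
def pathCost {d : ℕ} (ℓ : ℝ → ℝ) (N : (ℝ → Vec d) → ℝ) (φ : ℝ → Vec d) : ℝ≥0∞ :=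
  ∫⁻ t in Icc (0:ℝ) 1, ENNReal.ofReal (N φ * ℓ (‖φ t‖ / N φ))

/-- The modified Lagrangian cost `Ṽᵢ(P₀,P₁)`; take `N := N₁` resp. `N := N₂`. -/
def Vtilde {d : ℕ} (ℓ : ℝ → ℝ) (N : (ℝ → Vec d) → ℝ) (P₀ P₁ : Measure (Vec d)) : ℝ≥0∞ :=
  sInf { c | ∃ (Ω : Type) (_ : MeasureSpace Ω) (ξ : Ω → Vec d) (φ : Ω → ℝ → Vec d),
    IsAdmissible P₀ P₁ Ω ξ φ ∧ c = ∫⁻ ω, pathCost ℓ N (φ ω) }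

/-- `X(·)` (given by start `ξ` and velocity `φ`) is a minimizer of `Ṽᵢ(P₀,P₁)`. -/
def IsVtildeMin {d : ℕ} (ℓ : ℝ → ℝ) (N : (ℝ → Vec d) → ℝ) (P₀ P₁ : Measure (Vec d))
    (Ω : Type) [MeasureSpace Ω] (ξ : Ω → Vec d) (φ : Ω → ℝ → Vec d) : Prop :=
  IsAdmissible P₀ P₁ Ω ξ φ ∧ (∫⁻ ω, pathCost ℓ N (φ ω)) = Vtilde ℓ N P₀ P₁

/-- `X(t;x,y,A) = x + (|A∩[0,t]|/|A|)(y-x)` if `x ≠ y` and `|A| > 0`, else `x`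
(for `A ⊆ [0,1]`). -/
def XPath {d : ℕ} (x y : Vec d) (A : Set ℝ) (t : ℝ) : Vec d :=
  if x ≠ y ∧ 0 < volume A then
    x + (((volume (A ∩ Icc (0:ℝ) t)).toReal) / ((volume A).toReal)) • (y - x)
  else x

/-- the velocity (a.e. derivative) of `t ↦ X(t;x,y,A)` (for `A ⊆ [0,1]`). -/
def XVel {d : ℕ} (x y : Vec d) (A : Set ℝ) (s : ℝ) : Vec d :=
  if x ≠ y ∧ 0 < volume A then
    (if s ∈ A then ((volume A).toReal)⁻¹ • (y - x) else 0)
  else 0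

/-- `A : Ω → Set ℝ` is a random measurable subset of `[0,1]`. -/
def IsRandomSet (Ω : Type) [MeasureSpace Ω] (A : Ω → Set ℝ) : Prop :=
  (∀ ω, A ω ⊆ Icc (0:ℝ) 1) ∧ MeasurableSet {p : Ω × ℝ | p.2 ∈ A p.1}

/-- `V(P₀,P₁;B)`: the value of the stochastic optimal transport over pairs `(X,M)` with
`X ∈ 𝒜_∞(P₀,P₁)`, `M` a nonnegative random variable with law in `B` and `‖X'‖_∞ ≤ M` a.s. -/
def Vval {d : ℕ} (ℓ : ℝ → ℝ) (P₀ P₁ : Measure (Vec d)) (B : Set (Measure ℝ)) : ℝ≥0∞ :=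
  sInf { c | ∃ (Ω : Type) (_ : MeasureSpace Ω), IsProbabilityMeasure (volume : Measure Ω) ∧
    ∃ (ξ : Ω → Vec d) (φ : Ω → ℝ → Vec d) (M : Ω → ℝ),
      Measurable ξ ∧ Measurable (Function.uncurry φ) ∧ Measurable M ∧
      (∀ᵐ ω ∂(volume : Measure Ω), 0 ≤ M ω) ∧ Measure.map M volume ∈ B ∧
      (∀ᵐ ω ∂(volume : Measure Ω), eSup01 (φ ω) ≤ ENNReal.ofReal (M ω)) ∧
      Measure.map ξ volume = P₀ ∧ Measure.map (fun ω => endPt (ξ ω) (φ ω)) volume = P₁ ∧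
      c = ∫⁻ ω, ∫⁻ t in Icc (0:ℝ) 1, ENNReal.ofReal (ℓ ‖φ ω t‖) }

/-- `T^V(P₀,P₁;B) = inf E[ℓ(M) M⁻¹ |X₁-X₀| ; M > 0]` over `(X₀,X₁,M) ∈ Π_∞(P₀,P₁;B)`. -/
def TVval {d : ℕ} (ℓ : ℝ → ℝ) (P₀ P₁ : Measure (Vec d)) (B : Set (Measure ℝ)) : ℝ≥0∞ :=
  sInf { c | ∃ (Ω : Type) (_ : MeasureSpace Ω), IsProbabilityMeasure (volume : Measure Ω) ∧
    ∃ (X₀ X₁ : Ω → Vec d) (M : Ω → ℝ),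
      Measurable X₀ ∧ Measurable X₁ ∧ Measurable M ∧
      (∀ᵐ ω ∂(volume : Measure Ω), 0 ≤ M ω) ∧ Measure.map M volume ∈ B ∧
      (∀ᵐ ω ∂(volume : Measure Ω), ‖X₁ ω - X₀ ω‖ ≤ M ω) ∧
      Measure.map X₀ volume = P₀ ∧ Measure.map X₁ volume = P₁ ∧
      c = ∫⁻ ω in {ω | 0 < M ω}, ENNReal.ofReal (ℓ (M ω) / M ω * ‖X₁ ω - X₀ ω‖) }

/-- `((ξ,φ), M)` is an admissible pair for `V(P₀,P₁;B)`. -/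
def IsVvalAdmissible {d : ℕ} (P₀ P₁ : Measure (Vec d)) (B : Set (Measure ℝ)) (Ω : Type)
    [MeasureSpace Ω] (ξ : Ω → Vec d) (φ : Ω → ℝ → Vec d) (M : Ω → ℝ) : Prop :=
  IsProbabilityMeasure (volume : Measure Ω) ∧
  Measurable ξ ∧ Measurable (Function.uncurry φ) ∧ Measurable M ∧
  (∀ᵐ ω ∂(volume : Measure Ω), 0 ≤ M ω) ∧ Measure.map M volume ∈ B ∧
  (∀ᵐ ω ∂(volume : Measure Ω), eSup01 (φ ω) ≤ ENNReal.ofReal (M ω)) ∧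
  Measure.map ξ volume = P₀ ∧ Measure.map (fun ω => endPt (ξ ω) (φ ω)) volume = P₁

/-- `((ξ,φ), M)` is a minimizer of `V(P₀,P₁;B)`. -/
def IsVvalMin {d : ℕ} (ℓ : ℝ → ℝ) (P₀ P₁ : Measure (Vec d)) (B : Set (Measure ℝ)) (Ω : Type)
    [MeasureSpace Ω] (ξ : Ω → Vec d) (φ : Ω → ℝ → Vec d) (M : Ω → ℝ) : Prop :=
  IsVvalAdmissible P₀ P₁ B Ω ξ φ M ∧
  (∫⁻ ω, ∫⁻ t in Icc (0:ℝ) 1, ENNReal.ofReal (ℓ ‖φ ω t‖)) = Vval ℓ P₀ P₁ B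

/-- `(X₀,X₁,M)` is an admissible triplet in `Π_∞(P₀,P₁;B)`. -/
def IsTVAdmissible {d : ℕ} (P₀ P₁ : Measure (Vec d)) (B : Set (Measure ℝ)) (Ω : Type)
    [MeasureSpace Ω] (X₀ X₁ : Ω → Vec d) (M : Ω → ℝ) : Prop :=
  IsProbabilityMeasure (volume : Measure Ω) ∧ Measurable X₀ ∧ Measurable X₁ ∧ Measurable M ∧
  (∀ᵐ ω ∂(volume : Measure Ω), 0 ≤ M ω) ∧ Measure.map M volume ∈ B ∧
  (∀ᵐ ω ∂(volume : Measure Ω), ‖X₁ ω - X₀ ω‖ ≤ M ω) ∧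
  Measure.map X₀ volume = P₀ ∧ Measure.map X₁ volume = P₁

/-- `(X₀,X₁,M)` is a minimizer of `T^V(P₀,P₁;B)`. -/
def IsTVMin {d : ℕ} (ℓ : ℝ → ℝ) (P₀ P₁ : Measure (Vec d)) (B : Set (Measure ℝ)) (Ω : Type)
    [MeasureSpace Ω] (X₀ X₁ : Ω → Vec d) (M : Ω → ℝ) : Prop :=
  IsTVAdmissible P₀ P₁ B Ω X₀ X₁ M ∧
  (∫⁻ ω in {ω | 0 < M ω}, ENNReal.ofReal (ℓ (M ω) / M ω * ‖X₁ ω - X₀ ω‖)) = TVval ℓ P₀ P₁ B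


/-- the unconstrained value `inf{E[∫₀¹ ℓ(|X'(t)|) dt] : X ∈ 𝒜_∞(P₀,P₁)}`. -/
def VInfPlain {d : ℕ} (ℓ : ℝ → ℝ) (P₀ P₁ : Measure (Vec d)) : ℝ≥0∞ :=
  sInf { c | ∃ (Ω : Type) (_ : MeasureSpace Ω) (ξ : Ω → Vec d) (φ : Ω → ℝ → Vec d),
    IsAdmissible P₀ P₁ Ω ξ φ ∧ c = ∫⁻ ω, ∫⁻ t in Icc (0:ℝ) 1, ENNReal.ofReal (ℓ ‖φ ω t‖) }

/-- the value `V(P₀,P₁) = inf{E[∫₀¹ L(X'(t)) dt] : X ∈ 𝒜(P₀,P₁)}`, over stochastic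
processes with a.s. absolutely continuous (integrable derivative) paths. -/
def Vplain {d : ℕ} (L : Vec d → ℝ) (P₀ P₁ : Measure (Vec d)) : ℝ≥0∞ :=
  sInf { c | ∃ (Ω : Type) (_ : MeasureSpace Ω), IsProbabilityMeasure (volume : Measure Ω) ∧
    ∃ (ξ : Ω → Vec d) (φ : Ω → ℝ → Vec d),
      Measurable ξ ∧ Measurable (Function.uncurry φ) ∧
      (∀ᵐ ω ∂(volume : Measure Ω), IntegrableOn (φ ω) (Icc (0:ℝ) 1)) ∧
      Measure.map ξ volume = P₀ ∧ Measure.map (fun ω => endPt (ξ ω) (φ ω)) volume = P₁ ∧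
      c = ∫⁻ ω, ∫⁻ t in Icc (0:ℝ) 1, ENNReal.ofReal (L (φ ω t)) }

/-- the (topological) support of a Borel measure on `ℝ^d`. -/
def msupport {d : ℕ} (μ : Measure (Vec d)) : Set (Vec d) :=
  {x | ∀ ε : ℝ, 0 < ε → 0 < μ (Metric.ball x ε)}

end
lemma aux_N1_const {d : ℕ} (c : Vec d) : N1 (fun _ : ℝ => c) = 1 := by
  unfold N1 N1T eSupT
  split_ifs with h
  · have hc : c ≠ 0 := by simpa using h
    have hne : volume.restrict (Icc (0:ℝ) 1) ≠ 0 := by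
      intro h0
      have := congrArg (fun μ => μ univ) h0
      simp at this
    rw [essSup_const _ hne]
    have hc' : ‖c‖ ≠ 0 := norm_ne_zero_iff.2 hc
    simp [hc']
  · rfl

lemma aux_pathCost_const {d : ℕ} (ℓ : ℝ → ℝ) (c : Vec d) :
    pathCost ℓ N1 (fun _ : ℝ => c) = ENNReal.ofReal (ℓ ‖c‖) := by
  unfold pathCost
  rw [aux_N1_const]
  simp

lemma aux_lower {d : ℕ} (ℓ : ℝ → ℝ)
    (hℓnn : ∀ u : ℝ, 0 ≤ u → 0 ≤ ℓ u) (hℓ0 : ℓ 0 = 0)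
    (hA1i : ∀ r u : ℝ, 0 < r → r < 1 → 0 < u → r * ℓ u ≤ ℓ (r * u))
    (φ : ℝ → Vec d) (hS : eSup01 φ < ⊤) :
    ENNReal.ofReal (ℓ ‖∫ s in (0:ℝ)..1, φ s‖) ≤ pathCost ℓ N1 φ := by
  by_cases hv : (∫ s in (0:ℝ)..1, φ s) = 0
  · simp [hv, hℓ0]
  set v := ∫ s in (0:ℝ)..1, φ s with hvdef
  have hvpos : 0 < ‖v‖ := norm_pos_iff.2 hv
  have hae : ∀ᵐ t ∂(volume.restrict (Icc (0:ℝ) 1)), (‖φ t‖₊ : ℝ≥0∞) ≤ eSup01 φ :=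
    ENNReal.ae_le_essSup _
  have hint : ‖v‖ₑ ≤ ∫⁻ t in Icc (0:ℝ) 1, ‖φ t‖ₑ := by
    rw [hvdef, intervalIntegral.integral_of_le zero_le_one, ← integral_Icc_eq_integral_Ioc]
    exact enorm_integral_le_lintegral_enorm _
  have hvS : ‖v‖ₑ ≤ eSup01 φ := by
    refine hint.trans ((lintegral_mono_ae hae).trans ?_)
    simp
  set S := (eSup01 φ).toReal with hSdef
  have hSpos : 0 < S := by
    refine ENNReal.toReal_pos ?_ hS.ne
    intro h0
    rw [h0] at hvS
    simp at hvS
    exact hv hvS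
  have hN : N1 φ = S / ‖v‖ := by
    unfold N1 N1T
    rw [if_pos hv, one_mul]
    rfl
  have hNpos : 0 < S / ‖v‖ := by positivity
  have hkv : 0 ≤ ℓ ‖v‖ / ‖v‖ := div_nonneg (hℓnn _ hvpos.le) hvpos.le
  calc ENNReal.ofReal (ℓ ‖v‖) = ENNReal.ofReal (ℓ ‖v‖ / ‖v‖) * ‖v‖ₑ := by
        rw [← ofReal_norm, ← ENNReal.ofReal_mul hkv]
        congr 1
        field_simp
    _ ≤ ENNReal.ofReal (ℓ ‖v‖ / ‖v‖) * ∫⁻ t in Icc (0:ℝ) 1, ‖φ t‖ₑ := by gcongr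
    _ ≤ ∫⁻ t in Icc (0:ℝ) 1, ENNReal.ofReal (ℓ ‖v‖ / ‖v‖) * ‖φ t‖ₑ := lintegral_const_mul_le _ _
    _ ≤ pathCost ℓ N1 φ := by
        unfold pathCost
        rw [hN]
        refine lintegral_mono_ae ?_
        filter_upwards [hae] with t ht
        rw [← ofReal_norm, ← ENNReal.ofReal_mul hkv]
        refine ENNReal.ofReal_le_ofReal ?_
        have htS : ‖φ t‖ ≤ S := by
          have := ENNReal.toReal_mono hS.ne ht
          simpa using this
        rcases (norm_nonneg (φ t)).eq_or_lt with h0 | h0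
        · rw [← h0]; simp [hℓ0]
        rcases htS.eq_or_lt with h1 | h1
        · rw [h1]
          apply le_of_eq
          have : S / (S / ‖v‖) = ‖v‖ := by field_simp
          rw [this]; ring
        · have h2 := hA1i (‖φ t‖ / S) ‖v‖ (by positivity) ((div_lt_one hSpos).2 h1) hvpos
          have h3 : ‖φ t‖ / (S / ‖v‖) = ‖φ t‖ / S * ‖v‖ := by field_simp
          rw [h3]
          calc ℓ ‖v‖ / ‖v‖ * ‖φ t‖ = S / ‖v‖ * (‖φ t‖ / S * ℓ ‖v‖) := by field_simp
            _ ≤ _ := by gcongr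

lemma aux_upper {d : ℕ} (ℓ : ℝ → ℝ) (P₀ P₁ : Measure (Vec d)) :
    Vtilde ℓ N1 P₀ P₁ ≤ MKcost (fun u => ℓ ‖u‖) P₀ P₁ := by
  unfold MKcost
  refine le_sInf ?_
  rintro c ⟨Ω, m, hP, X₀, X₁, h0, h1, hm0, hm1, rfl⟩
  refine sInf_le ⟨Ω, m, X₀, fun ω _ => X₁ ω - X₀ ω, ⟨hP, h0, ?_, ?_, hm0, ?_⟩, ?_⟩
  · exact (h1.sub h0).comp measurable_fst
  · refine ae_of_all _ fun ω => ?_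
    unfold eSup01 eSupT
    refine lt_of_le_of_lt (essSup_le_of_ae_le _ (ae_of_all _ fun _ => le_rfl)) ?_
    exact ENNReal.coe_lt_top
  · simpa [endPt] using hm1
  · simp only [aux_pathCost_const]

/-- Theorem 2.1 (iii), first part: under (A1,i), if `X(·)` is a
minimizer of `Ṽ₁(P₀,P₁)` then `(X(0), X(1))` is a minimizer of `T(P₀,P₁)` with cost
`L(u) = ℓ(|u|)`. -/
theorem statement2 {d : ℕ} (hd : 1 ≤ d) (ℓ : ℝ → ℝ)
    (hℓnn : ∀ u : ℝ, 0 ≤ u → 0 ≤ ℓ u) (hℓ0 : ℓ 0 = 0)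
    (hA1i : ∀ r u : ℝ, 0 < r → r < 1 → 0 < u → r * ℓ u ≤ ℓ (r * u))
    (P₀ P₁ : Measure (Vec d)) [IsProbabilityMeasure P₀] [IsProbabilityMeasure P₁]
    (Ω : Type) [MeasureSpace Ω] (ξ : Ω → Vec d) (φ : Ω → ℝ → Vec d)
    (hmin : IsVtildeMin ℓ N1 P₀ P₁ Ω ξ φ) :
    IsTMin (fun u => ℓ ‖u‖) P₀ P₁ Ω ξ (fun ω => endPt (ξ ω) (φ ω)) := by
  obtain ⟨⟨hP, hξ, hφ, hS, h0, h1⟩, hV⟩ := hmin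
  have hmeas : Measurable (fun ω => endPt (ξ ω) (φ ω)) := by
    unfold endPt
    refine hξ.add ?_
    simp only [intervalIntegral.integral_of_le (zero_le_one (α := ℝ))]
    exact (hφ.stronglyMeasurable.integral_prod_right (ν := volume.restrict (Ioc (0:ℝ) 1))).measurable
  refine ⟨hP, hξ, hmeas, h0, h1, le_antisymm ?_ ?_⟩
  · refine le_trans ?_ (hV.le.trans (aux_upper ℓ P₀ P₁))
    refine lintegral_mono_ae ?_
    filter_upwards [hS] with ω hω
    have := aux_lower ℓ hℓnn hℓ0 hA1i (φ ω) hω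
    simpa [endPt] using this
  · exact sInf_le ⟨Ω, _, hP, ξ, _, hξ, hmeas, h0, h1, rfl⟩
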